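/- Let n ≥ 1 and let γ satisfy: γ > 1/2 if n = 1, γ > 0 if n = 2, γ ≥ 0 if n ≥ 3, and let u₁ ∈ L^{1,γ}(ℝⁿ). Then lim_{t→∞} t^{n/4+γ/2−1/2} · ( ∫_{|ξ|≤1} | E₁(t,ξ) û₁(ξ) − Σ_{k=0}^{⌊γ⌋} e₁^k(t,ξ) ( Σ_{j=0}^{⌊γ⌋−k} m[u₁]^j(ξ) ) |² dξ )^{1/2} = 0. -/

import Mathlib

open MeasureTheory Filter

noncomputable section

/-- Euclidean space `ℝⁿ`. -/
abbrev Rn (n : ℕ) := EuclideanSpace ℝ (Fin n)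

/-- Fourier transform `f̂(ξ) = ∫ e^{-i x·ξ} f(x) dx` of a real-valued `f`. -/
def fourierHat (n : ℕ) (f : Rn n → ℝ) (ξ : Rn n) : ℂ :=
  ∫ x : Rn n, Complex.exp (-Complex.I * ((∑ i, x i * ξ i : ℝ) : ℂ)) * (f x : ℂ)

/-- Membership in the weighted space `L^{1,γ}(ℝⁿ)`. -/
def MemL1w (n : ℕ) (γ : ℝ) (f : Rn n → ℝ) : Prop :=
  MeasureTheory.Integrable f ∧
    MeasureTheory.Integrable (fun x : Rn n => (1 + ‖x‖) ^ γ * |f x|)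

/-- The weighted norm `‖f‖_{1,γ}`. -/
def wnorm (n : ℕ) (γ : ℝ) (f : Rn n → ℝ) : ℝ :=
  ∫ x : Rn n, (1 + ‖x‖) ^ γ * |f x|

/-- The evolution operator multiplier `E₀(t,ξ)`. -/
def E0 (n : ℕ) (t : ℝ) (ξ : Rn n) : ℝ :=
  if ‖ξ‖ ≤ 2 then
    Real.exp (-(t * ‖ξ‖ ^ 2) / 2) * Real.cos (t * ‖ξ‖ * Real.sqrt (4 - ‖ξ‖ ^ 2) / 2)
  else
    Real.exp (-(t * ‖ξ‖ ^ 2) / 2) * Real.cosh (t * ‖ξ‖ * Real.sqrt (‖ξ‖ ^ 2 - 4) / 2)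

/-- The evolution operator multiplier `E₁(t,ξ)`. -/
def E1 (n : ℕ) (t : ℝ) (ξ : Rn n) : ℝ :=
  if ‖ξ‖ ≤ 2 then
    Real.exp (-(t * ‖ξ‖ ^ 2) / 2) *
      (Real.sin (t * ‖ξ‖ * Real.sqrt (4 - ‖ξ‖ ^ 2) / 2) /
        (‖ξ‖ * Real.sqrt (4 - ‖ξ‖ ^ 2) / 2))
  else
    Real.exp (-(t * ‖ξ‖ ^ 2) / 2) *
      (Real.sinh (t * ‖ξ‖ * Real.sqrt (‖ξ‖ ^ 2 - 4) / 2) /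
        (‖ξ‖ * Real.sqrt (‖ξ‖ ^ 2 - 4) / 2))

/-- `L₀(a,t,ξ)` as a function of `a`. -/
def L0fun (n : ℕ) (t : ℝ) (ξ : Rn n) (a : ℝ) : ℝ :=
  Real.cos (t * ‖ξ‖ - t * ‖ξ‖ ^ 2 * (a / (4 + 2 * Real.sqrt (4 - a ^ 2))))

/-- `L₁(a,t,ξ)` as a function of `a`. -/
def L1fun (n : ℕ) (t : ℝ) (ξ : Rn n) (a : ℝ) : ℝ :=
  Real.sin (t * ‖ξ‖ - t * ‖ξ‖ ^ 2 * (a / (4 + 2 * Real.sqrt (4 - a ^ 2)))) /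
    (‖ξ‖ * Real.sqrt (4 - a ^ 2) / 2)

/-- `e₀^k(t,ξ) = e^{-t|ξ|²/2} (1/k!) (∂^k L₀/∂a^k)(0,t,ξ) |ξ|^k`. -/
def e0 (n : ℕ) (k : ℕ) (t : ℝ) (ξ : Rn n) : ℝ :=
  Real.exp (-(t * ‖ξ‖ ^ 2) / 2) * ((1 : ℝ) / k.factorial) *
    iteratedDeriv k (L0fun n t ξ) 0 * ‖ξ‖ ^ k

/-- `e₁^k(t,ξ) = e^{-t|ξ|²/2} (1/k!) (∂^k L₁/∂a^k)(0,t,ξ) |ξ|^k`. -/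
def e1 (n : ℕ) (k : ℕ) (t : ℝ) (ξ : Rn n) : ℝ :=
  Real.exp (-(t * ‖ξ‖ ^ 2) / 2) * ((1 : ℝ) / k.factorial) *
    iteratedDeriv k (L1fun n t ξ) 0 * ‖ξ‖ ^ k

/-- The moment polynomial
`m[f]^k(ξ) = ∑_{|α|=k} ((-1)^{|α|}/α!) (∫ x^α f(x) dx) (iξ)^α`. -/
def mom (n : ℕ) (f : Rn n → ℝ) (k : ℕ) (ξ : Rn n) : ℂ :=
  ∑ α ∈ Finset.univ.filter (fun α : Fin n → Fin (k + 1) => ∑ i, (α i).val = k),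
    ((-1 : ℂ) ^ k / ∏ i, ((α i).val.factorial : ℂ)) *
      ((∫ x : Rn n, (∏ i, x i ^ (α i).val) * f x : ℝ) : ℂ) *
      ∏ i, (Complex.I * (ξ i : ℂ)) ^ (α i).val

/-- The Fourier-space solution of the strongly damped wave equation. -/
def uhat (n : ℕ) (u₀ u₁ : Rn n → ℝ) (t : ℝ) (ξ : Rn n) : ℂ :=
  (E0 n t ξ : ℂ) * fourierHat n u₀ ξ +
    (E1 n t ξ : ℂ) * (((‖ξ‖ ^ 2 / 2 : ℝ) : ℂ) * fourierHat n u₀ ξ + fourierHat n u₁ ξ)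

/-- Derivatives of an oscillating function `h · sin (p - q g)` grow at most polynomially in `q`,
uniformly in the phase `p`. -/
lemma exists_iteratedDerivWithin_mul_sin_le {g : ℝ → ℝ}
    (hg : ContDiffOn ℝ ⊤ g (Set.Icc 0 1)) (k : ℕ) :
    ∀ {h : ℝ → ℝ}, ContDiffOn ℝ ⊤ h (Set.Icc 0 1) →
    ∃ C, 0 ≤ C ∧ ∀ p q : ℝ, 0 ≤ q → ∀ a ∈ Set.Icc (0 : ℝ) 1,
      |iteratedDerivWithin k (fun a => h a * Real.sin (p - q * g a)) (Set.Icc 0 1) a| ≤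
        C * (1 + q) ^ k := by
  have hU : UniqueDiffOn ℝ (Set.Icc (0 : ℝ) 1) := uniqueDiffOn_Icc one_pos
  have hg' : ContDiffOn ℝ ⊤ (derivWithin g (Set.Icc 0 1)) (Set.Icc 0 1) :=
    hg.derivWithin hU (by simp)
  induction k with
  | zero =>
    intro h hh
    obtain ⟨C, hC⟩ := isCompact_Icc.exists_bound_of_continuousOn hh.continuousOn
    refine ⟨|C|, abs_nonneg _, fun p q _ a ha => ?_⟩
    simp only [iteratedDerivWithin_zero, abs_mul, pow_zero, mul_one]
    calc _ ≤ |h a| * 1 := by gcongr; exact Real.abs_sin_le_one _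
      _ ≤ |C| := by rw [mul_one]; exact (hC a ha).trans (le_abs_self _)
  | succ k ih =>
    intro h hh
    have hh' : ContDiffOn ℝ ⊤ (derivWithin h (Set.Icc 0 1)) (Set.Icc 0 1) :=
      hh.derivWithin hU (by simp)
    obtain ⟨C₁, hC₁, h₁⟩ := ih hh'
    obtain ⟨C₂, hC₂, h₂⟩ := ih (hh.mul hg')
    refine ⟨C₁ + C₂, by positivity, fun p q hq a ha => ?_⟩
    have smooth : ∀ {f : ℝ → ℝ} (p : ℝ), ContDiffOn ℝ ⊤ f (Set.Icc 0 1) →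
        ContDiffOn ℝ ⊤ (fun a => f a * Real.sin (p - q * g a)) (Set.Icc 0 1) := fun p hf =>
      hf.mul (Real.contDiff_sin.comp_contDiffOn (contDiffOn_const.sub (contDiffOn_const.mul hg)))
    have hderiv : Set.EqOn
        (derivWithin (fun a => h a * Real.sin (p - q * g a)) (Set.Icc 0 1))
        (fun a => derivWithin h (Set.Icc 0 1) a * Real.sin (p - q * g a) -
          q * (h a * derivWithin g (Set.Icc 0 1) a * Real.sin ((p + Real.pi / 2) - q * g a)))
        (Set.Icc 0 1) := by
      intro b hb
      have e₁ := (hh.differentiableOn (by simp) b hb).hasDerivWithinAt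
      have e₂ := (hg.differentiableOn (by simp) b hb).hasDerivWithinAt
      have e₃ := e₁.mul ((e₂.const_mul q).const_sub p).sin
      refine (e₃.derivWithin (hU b hb)).trans ?_
      beta_reduce
      rw [show p + Real.pi / 2 - q * g b = (p - q * g b) + Real.pi / 2 by ring,
        Real.sin_add_pi_div_two]
      ring
    rw [iteratedDerivWithin_succ', iteratedDerivWithin_congr hderiv ha]
    have hs₁ : ContDiffWithinAt ℝ k (fun a => derivWithin h (Set.Icc 0 1) a *
        Real.sin (p - q * g a)) (Set.Icc 0 1) a := ((smooth p hh').of_le (by simp)) a ha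
    have hs₂ : ContDiffWithinAt ℝ k (fun a => h a * derivWithin g (Set.Icc 0 1) a *
        Real.sin ((p + Real.pi / 2) - q * g a)) (Set.Icc 0 1) a :=
      ((smooth (p + Real.pi / 2) (hh.mul hg')).of_le (by simp)) a ha
    have hsub := iteratedDerivWithin_sub ha hU hs₁ (contDiffWithinAt_const (c := q) |>.mul hs₂)
    refine (congrArg abs hsub).trans_le ?_
    rw [iteratedDerivWithin_const_mul_field]
    have b₁ := h₁ p q hq a ha
    have b₂ := h₂ (p + Real.pi / 2) q hq a ha
    calc _ ≤ C₁ * (1 + q) ^ k + q * (C₂ * (1 + q) ^ k) := by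
          refine (abs_sub _ _).trans ?_
          rw [abs_mul, abs_of_nonneg hq]
          gcongr
      _ ≤ (C₁ + C₂) * (1 + q) ^ (k + 1) := by
          have : 0 ≤ C₁ * (1 + q) ^ k * q + C₂ * (1 + q) ^ k := by positivity
          rw [pow_succ]; nlinarith

lemma exists_pow_mul_exp_neg_le (m : ℕ) :
    ∃ C : ℝ, 0 ≤ C ∧ ∀ q : ℝ, 0 ≤ q →
      (1 + q) ^ m * Real.exp (-q / 2) ≤ C * Real.exp (-q / 4) := by
  refine ⟨4 ^ m * m.factorial * Real.exp (1 / 4), by positivity, fun q hq => ?_⟩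
  have h := Real.pow_div_factorial_le_exp ((1 + q) / 4) (by positivity) m
  rw [div_pow, div_div, div_le_iff₀ (by positivity)] at h
  calc (1 + q) ^ m * Real.exp (-q / 2)
      ≤ Real.exp ((1 + q) / 4) * (4 ^ m * m.factorial) * Real.exp (-q / 2) := by gcongr
    _ = _ := by
      rw [show -q / 4 = -q / 2 + q / 4 by ring, show (1 + q) / 4 = 1 / 4 + q / 4 by ring,
        Real.exp_add, Real.exp_add]
      ring

/-- The nonlinear part of the phase of `L₁`. -/
def phase (a : ℝ) : ℝ := a / (4 + 2 * Real.sqrt (4 - a ^ 2))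

/-- The amplitude of `|ξ| L₁`. -/
def amplitude (a : ℝ) : ℝ := 1 / (Real.sqrt (4 - a ^ 2) / 2)

/-- The function `|ξ| L₁` in terms of `p = t|ξ|` and `q = t|ξ|²`. -/
def scaledL1 (p q a : ℝ) : ℝ := amplitude a * Real.sin (p - q * phase a)

lemma contDiffAt_sqrt_four_sub_sq {a : ℝ} (ha : a ^ 2 < 4) :
    ContDiffAt ℝ ⊤ (fun a : ℝ => Real.sqrt (4 - a ^ 2)) a :=
  (contDiffAt_const.sub (contDiffAt_id.pow 2)).sqrt (by simpa using (sub_pos.2 ha).ne')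

lemma contDiffAt_phase {a : ℝ} (ha : a ^ 2 < 4) : ContDiffAt ℝ ⊤ phase a :=
  contDiffAt_id.div (contDiffAt_const.add (contDiffAt_const.mul (contDiffAt_sqrt_four_sub_sq ha)))
    (by positivity)

lemma contDiffAt_amplitude {a : ℝ} (ha : a ^ 2 < 4) : ContDiffAt ℝ ⊤ amplitude a :=
  contDiffAt_const.div ((contDiffAt_sqrt_four_sub_sq ha).div_const 2)
    (by have := Real.sqrt_pos.2 (sub_pos.2 ha); positivity)

lemma contDiffAt_scaledL1 (p q : ℝ) {a : ℝ} (ha : a ^ 2 < 4) :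
    ContDiffAt ℝ ⊤ (scaledL1 p q) a :=
  (contDiffAt_amplitude ha).mul
    (Real.contDiff_sin.contDiffAt.comp a
      (contDiffAt_const.sub (contDiffAt_const.mul (contDiffAt_phase ha))))

lemma sq_lt_four_of_mem_Icc {a : ℝ} (ha : a ∈ Set.Icc (0 : ℝ) 1) : a ^ 2 < 4 := by
  nlinarith [ha.1, ha.2]

lemma exists_iteratedDerivWithin_scaledL1_le (k : ℕ) :
    ∃ C, 0 ≤ C ∧ ∀ p q : ℝ, 0 ≤ q → ∀ a ∈ Set.Icc (0 : ℝ) 1,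
      |iteratedDerivWithin k (scaledL1 p q) (Set.Icc 0 1) a| ≤ C * (1 + q) ^ k :=
  exists_iteratedDerivWithin_mul_sin_le
    (fun _ ha => (contDiffAt_phase (sq_lt_four_of_mem_Icc ha)).contDiffWithinAt) k
    (fun _ ha => (contDiffAt_amplitude (sq_lt_four_of_mem_Icc ha)).contDiffWithinAt)

lemma L1fun_eq_scaledL1 (n : ℕ) (t : ℝ) (ξ : Rn n) (a : ℝ) :
    L1fun n t ξ a = ‖ξ‖⁻¹ * scaledL1 (t * ‖ξ‖) (t * ‖ξ‖ ^ 2) a := by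
  simp only [L1fun, scaledL1, amplitude, phase, div_eq_mul_inv, mul_inv]
  ring

lemma e1_eq_scaledL1 (n k : ℕ) (t : ℝ) (ξ : Rn n) :
    e1 n k t ξ = Real.exp (-(t * ‖ξ‖ ^ 2) / 2) * ‖ξ‖⁻¹ *
      (((k.factorial : ℝ)⁻¹ * ‖ξ‖ ^ k) *
        iteratedDerivWithin k (scaledL1 (t * ‖ξ‖) (t * ‖ξ‖ ^ 2)) (Set.Icc 0 1) 0) := by
  have h0 : (0 : ℝ) ∈ Set.Icc (0 : ℝ) 1 := by simp
  have hfun : L1fun n t ξ = fun a => ‖ξ‖⁻¹ * scaledL1 (t * ‖ξ‖) (t * ‖ξ‖ ^ 2) a :=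
    funext (L1fun_eq_scaledL1 n t ξ)
  rw [e1, hfun, iteratedDeriv_const_mul_field,
    iteratedDerivWithin_eq_iteratedDeriv (uniqueDiffOn_Icc one_pos)
      ((contDiffAt_scaledL1 _ _ (sq_lt_four_of_mem_Icc h0)).of_le (by simp)) h0]
  ring

lemma E1_eq_scaledL1 (n : ℕ) (t : ℝ) {ξ : Rn n} (hξ : ‖ξ‖ ≤ 1) :
    E1 n t ξ = Real.exp (-(t * ‖ξ‖ ^ 2) / 2) * ‖ξ‖⁻¹ *
      scaledL1 (t * ‖ξ‖) (t * ‖ξ‖ ^ 2) ‖ξ‖ := by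
  have hs : 0 ≤ Real.sqrt (4 - ‖ξ‖ ^ 2) := Real.sqrt_nonneg _
  have hss : Real.sqrt (4 - ‖ξ‖ ^ 2) ^ 2 = 4 - ‖ξ‖ ^ 2 :=
    Real.sq_sqrt (by nlinarith [norm_nonneg ξ])
  have hphase : t * ‖ξ‖ * Real.sqrt (4 - ‖ξ‖ ^ 2) / 2 =
      t * ‖ξ‖ - t * ‖ξ‖ ^ 2 * phase ‖ξ‖ := by
    have : phase ‖ξ‖ * ‖ξ‖ = (2 - Real.sqrt (4 - ‖ξ‖ ^ 2)) / 2 := by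
      rw [phase, div_mul_eq_mul_div, div_eq_iff (by positivity)]
      linear_combination hss
    linear_combination t * ‖ξ‖ * this
  rw [E1, if_pos (by linarith), hphase, scaledL1, amplitude]
  simp only [div_eq_mul_inv, mul_inv]
  ring

lemma exists_e1_le (n k : ℕ) :
    ∃ C, 0 ≤ C ∧ ∀ (t : ℝ) (ξ : Rn n), 0 < t → ξ ≠ 0 →
      |e1 n k t ξ| ≤ C * Real.exp (-(t * ‖ξ‖ ^ 2) / 4) * (‖ξ‖⁻¹ * ‖ξ‖ ^ k) := by
  obtain ⟨C₁, hC₁, h₁⟩ := exists_iteratedDerivWithin_scaledL1_le k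
  obtain ⟨C₂, hC₂, h₂⟩ := exists_pow_mul_exp_neg_le k
  refine ⟨(k.factorial : ℝ)⁻¹ * C₁ * C₂, by positivity, fun t ξ ht hξ => ?_⟩
  have hq : 0 ≤ t * ‖ξ‖ ^ 2 := by positivity
  have b₁ := h₁ (t * ‖ξ‖) _ hq 0 (by simp)
  have b₂ := h₂ _ hq
  rw [e1_eq_scaledL1, abs_mul, abs_mul (_ * ‖ξ‖ ^ k), abs_of_nonneg (by positivity),
    abs_of_nonneg (a := _ * ‖ξ‖ ^ k) (by positivity)]
  calc _ ≤ Real.exp (-(t * ‖ξ‖ ^ 2) / 2) * ‖ξ‖⁻¹ * (((k.factorial : ℝ)⁻¹ * ‖ξ‖ ^ k) *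
          (C₁ * (1 + t * ‖ξ‖ ^ 2) ^ k)) := by gcongr
    _ = (k.factorial : ℝ)⁻¹ * C₁ * (‖ξ‖⁻¹ * ‖ξ‖ ^ k) *
          ((1 + t * ‖ξ‖ ^ 2) ^ k * Real.exp (-(t * ‖ξ‖ ^ 2) / 2)) := by ring
    _ ≤ (k.factorial : ℝ)⁻¹ * C₁ * (‖ξ‖⁻¹ * ‖ξ‖ ^ k) *
          (C₂ * Real.exp (-(t * ‖ξ‖ ^ 2) / 4)) := by gcongr
    _ = _ := by ring

lemma exists_E1_sub_sum_e1_le (n K : ℕ) :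
    ∃ C, 0 ≤ C ∧ ∀ (t : ℝ) (ξ : Rn n), 0 < t → ξ ≠ 0 → ‖ξ‖ ≤ 1 →
      |E1 n t ξ - ∑ k ∈ Finset.range (K + 1), e1 n k t ξ| ≤
        C * Real.exp (-(t * ‖ξ‖ ^ 2) / 4) * ‖ξ‖ ^ K := by
  obtain ⟨C₁, hC₁, h₁⟩ := exists_iteratedDerivWithin_scaledL1_le (K + 1)
  obtain ⟨C₂, hC₂, h₂⟩ := exists_pow_mul_exp_neg_le (K + 1)
  refine ⟨(K.factorial : ℝ)⁻¹ * C₁ * C₂, by positivity, fun t ξ ht hξ hξ1 => ?_⟩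
  have hr : 0 < ‖ξ‖ := norm_pos_iff.2 hξ
  have hq : 0 ≤ t * ‖ξ‖ ^ 2 := by positivity
  have b₂ := h₂ _ hq
  have taylor := taylor_mean_remainder_bound (f := scaledL1 (t * ‖ξ‖) (t * ‖ξ‖ ^ 2))
    (n := K) (x := ‖ξ‖) zero_le_one
    (fun a ha => ((contDiffAt_scaledL1 _ _ (sq_lt_four_of_mem_Icc ha)).of_le
      (by exact_mod_cast le_top)).contDiffWithinAt)
    ⟨hr.le, hξ1⟩ (h₁ _ _ hq)
  rw [taylor_within_apply, Real.norm_eq_abs] at taylor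
  simp only [sub_zero, smul_eq_mul] at taylor
  rw [E1_eq_scaledL1 n t hξ1]
  simp only [e1_eq_scaledL1]
  rw [← Finset.mul_sum, ← mul_sub, abs_mul, abs_of_nonneg (by positivity)]
  calc _ ≤ Real.exp (-(t * ‖ξ‖ ^ 2) / 2) * ‖ξ‖⁻¹ *
          (C₁ * (1 + t * ‖ξ‖ ^ 2) ^ (K + 1) * ‖ξ‖ ^ (K + 1) / K.factorial) := by gcongr
    _ = (K.factorial : ℝ)⁻¹ * C₁ * ‖ξ‖ ^ K *
          ((1 + t * ‖ξ‖ ^ 2) ^ (K + 1) * Real.exp (-(t * ‖ξ‖ ^ 2) / 2)) := by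
        rw [pow_succ ‖ξ‖]; field_simp; ring
    _ ≤ (K.factorial : ℝ)⁻¹ * C₁ * ‖ξ‖ ^ K *
          (C₂ * Real.exp (-(t * ‖ξ‖ ^ 2) / 4)) := by gcongr
    _ = _ := by ring

lemma abs_sum_mul_le_norm_mul_norm {n : ℕ} (x ξ : Rn n) : |∑ i, x i * ξ i| ≤ ‖x‖ * ‖ξ‖ := by
  have h := abs_real_inner_le_norm x ξ
  simpa [PiLp.inner_apply, mul_comm] using h

/-- The Taylor remainder of order `J` of `y ↦ e^{-iy}` at `0`. -/
def expRemainder (J : ℕ) (y : ℝ) : ℂ :=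
  Complex.exp (-Complex.I * y) - ∑ j ∈ Finset.range (J + 1), (-Complex.I * y) ^ j / j.factorial

lemma continuous_expRemainder (J : ℕ) : Continuous (expRemainder J) := by
  unfold expRemainder
  fun_prop

lemma exists_expRemainder_le (J : ℕ) :
    ∃ C, 0 ≤ C ∧ ∀ y : ℝ, ‖expRemainder J y‖ ≤ C * |y| ^ (J + 1) ∧
      ∀ β : ℝ, J ≤ β → β ≤ J + 1 → ‖expRemainder J y‖ ≤ C * |y| ^ β := by
  have hnorm : ∀ y : ℝ, ‖-Complex.I * (y : ℂ)‖ = |y| := by simp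
  refine ⟨J + 2 + Real.exp 1, by positivity, fun y => ?_⟩
  rcases le_total |y| 1 with hy | hy
  · have h : ‖expRemainder J y‖ ≤ (J + 2 + Real.exp 1) * |y| ^ (J + 1) := by
      refine (Complex.norm_exp_sub_sum_le_norm_mul_exp (-Complex.I * y) (J + 1)).trans ?_
      rw [hnorm, mul_comm]
      gcongr
      have := Real.exp_le_exp.2 hy
      linarith [(Nat.cast_nonneg J : (0 : ℝ) ≤ J)]
    refine ⟨h, fun β _ hβ => h.trans ?_⟩
    gcongr
    rcases (abs_nonneg y).eq_or_lt with h0 | h0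
    · rw [← h0, zero_pow (by omega)]; positivity
    · rw [← Real.rpow_natCast]
      exact Real.rpow_le_rpow_of_exponent_ge h0 hy (by exact_mod_cast hβ)
  · have h : ‖expRemainder J y‖ ≤ (J + 2 + Real.exp 1) * |y| ^ J := by
      have hexp : ‖Complex.exp (-Complex.I * (y : ℂ))‖ = 1 := by
        rw [Complex.norm_exp]; simp
      have hsum : ‖∑ j ∈ Finset.range (J + 1), (-Complex.I * (y : ℂ)) ^ j / j.factorial‖ ≤
          ∑ _j ∈ Finset.range (J + 1), |y| ^ J := by
        refine norm_sum_le_of_le _ fun j hj => ?_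
        rw [norm_div, norm_pow, hnorm, Complex.norm_natCast]
        refine (div_le_self (by positivity) (by exact_mod_cast j.factorial_pos)).trans ?_
        exact pow_le_pow_right₀ hy (by simpa [Nat.lt_succ_iff] using hj)
      rw [Finset.sum_const, Finset.card_range, nsmul_eq_mul] at hsum
      have h1 : 1 ≤ |y| ^ J := one_le_pow₀ hy
      have := norm_sub_le (Complex.exp (-Complex.I * (y : ℂ)))
        (∑ j ∈ Finset.range (J + 1), (-Complex.I * (y : ℂ)) ^ j / j.factorial)
      push_cast at hsum
      unfold expRemainder
      nlinarith [Real.exp_pos 1]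
    refine ⟨h.trans ?_, fun β hβ _ => h.trans ?_⟩
    · gcongr ?_ * ?_
      exact pow_le_pow_right₀ hy J.le_succ
    · gcongr
      rw [← Real.rpow_natCast]
      exact Real.rpow_le_rpow_of_exponent_le hy hβ

lemma sum_pow_div_factorial {n : ℕ} (z : Fin n → ℂ) (j : ℕ) :
    (∑ i, z i) ^ j / j.factorial =
      ∑ α ∈ Finset.univ.filter (fun α : Fin n → Fin (j + 1) => ∑ i, (α i).val = j),
        (∏ i, ((α i).val.factorial : ℂ))⁻¹ * ∏ i, z i ^ (α i).val := by
  rw [Finset.sum_pow_eq_sum_piAntidiag, Finset.sum_div]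
  symm
  refine Finset.sum_bij (fun α _ i => (α i).val) (fun α hα => by simpa using hα)
    (fun α _ β _ h => funext fun i => Fin.ext (congrFun h i)) (fun α hα => ?_) (fun α hα => ?_)
  · have hsum : ∑ i, α i = j := by simpa using hα
    have hle : ∀ i, α i < j + 1 := fun i => by
      have := Finset.single_le_sum (f := α) (fun _ _ => Nat.zero_le _) (Finset.mem_univ i)
      omega
    exact ⟨fun i => ⟨α i, hle i⟩, by simpa using hsum, rfl⟩
  · have hsum : ∑ i, (α i).val = j := by simpa using hα
    have hm := Nat.multinomial_spec Finset.univ (fun i => (α i).val)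
    rw [hsum] at hm
    have hm' : (∏ i, ((α i).val.factorial : ℂ)) *
        (Nat.multinomial Finset.univ (fun i => (α i).val) : ℂ) = j.factorial := by
      exact_mod_cast hm
    have h0 : (∏ i, ((α i).val.factorial : ℂ)) ≠ 0 :=
      Finset.prod_ne_zero_iff.2 fun i _ => by exact_mod_cast (α i).val.factorial_ne_zero
    have h1 : (j.factorial : ℂ) ≠ 0 := by exact_mod_cast j.factorial_ne_zero
    have h2 := right_ne_zero_of_mul (hm' ▸ h1)
    rw [← hm']
    field_simp

lemma MemL1w.mono {n : ℕ} {γ β : ℝ} {f : Rn n → ℝ} (hf : MemL1w n γ f) (h : β ≤ γ) :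
    MemL1w n β f := by
  refine ⟨hf.1, hf.2.mono ?_ (.of_forall fun x => ?_)⟩
  · refine AEStronglyMeasurable.mul ?_ hf.1.abs.aestronglyMeasurable
    exact ((measurable_const.add measurable_norm).pow_const β).aestronglyMeasurable
  · rw [norm_mul, norm_mul]
    gcongr
    rw [Real.norm_of_nonneg (by positivity), Real.norm_of_nonneg (by positivity)]
    exact Real.rpow_le_rpow_of_exponent_le (by linarith [norm_nonneg x]) h

lemma MemL1w.integrable_prod_pow_mul {n : ℕ} {γ : ℝ} {f : Rn n → ℝ} (hf : MemL1w n γ f)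
    (α : Fin n → ℕ) (h : (∑ i, α i : ℕ) ≤ γ) :
    Integrable (fun x : Rn n => (∏ i, x i ^ α i) * f x) := by
  refine hf.2.mono ?_ (.of_forall fun x => ?_)
  · refine AEStronglyMeasurable.mul (Continuous.aestronglyMeasurable ?_) hf.1.aestronglyMeasurable
    fun_prop
  · rw [norm_mul, norm_mul, Real.norm_eq_abs |f x|, abs_abs, Real.norm_eq_abs (f x)]
    gcongr
    rw [Real.norm_of_nonneg (r := (1 + ‖x‖) ^ γ) (by positivity), norm_prod]
    calc ∏ i, ‖x i ^ α i‖ ≤ ∏ i, (1 + ‖x‖) ^ α i := by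
          refine Finset.prod_le_prod (fun _ _ => norm_nonneg _) fun i _ => ?_
          rw [norm_pow]
          gcongr
          linarith [PiLp.norm_apply_le x i]
      _ = (1 + ‖x‖) ^ ((∑ i, α i : ℕ) : ℝ) := by
          rw [Finset.prod_pow_eq_pow_sum, Real.rpow_natCast]
      _ ≤ _ := Real.rpow_le_rpow_of_exponent_le (by linarith [norm_nonneg x]) h

lemma integrable_and_integral_eq_mom {n : ℕ} {γ : ℝ} {f : Rn n → ℝ} (hf : MemL1w n γ f)
    {j : ℕ} (hj : j ≤ γ) (ξ : Rn n) :
    Integrable (fun x : Rn n =>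
      (-Complex.I * ((∑ i, x i * ξ i : ℝ) : ℂ)) ^ j / j.factorial * (f x : ℂ)) ∧
    ∫ x : Rn n, (-Complex.I * ((∑ i, x i * ξ i : ℝ) : ℂ)) ^ j / j.factorial * (f x : ℂ) =
      mom n f j ξ := by
  have hpt : ∀ x : Rn n,
      (-Complex.I * ((∑ i, x i * ξ i : ℝ) : ℂ)) ^ j / j.factorial * (f x : ℂ) =
      ∑ α ∈ Finset.univ.filter (fun α : Fin n → Fin (j + 1) => ∑ i, (α i).val = j),
        ((-1 : ℂ) ^ j / ∏ i, ((α i).val.factorial : ℂ)) *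
          (((∏ i, x i ^ (α i).val) * f x : ℝ) : ℂ) *
          ∏ i, (Complex.I * (ξ i : ℂ)) ^ (α i).val := by
    intro x
    rw [show -Complex.I * ((∑ i, x i * ξ i : ℝ) : ℂ) =
      ∑ i, (-1) * (x i : ℂ) * (Complex.I * (ξ i : ℂ)) by
        push_cast
        rw [Finset.mul_sum]
        exact Finset.sum_congr rfl fun i _ => by ring,
      sum_pow_div_factorial, Finset.sum_mul]
    refine Finset.sum_congr rfl fun α hα => ?_
    have hsum : ∑ i, (α i).val = j := by simpa using hα
    simp only [mul_pow _ _ (Fin.val _), Finset.prod_mul_distrib, Finset.prod_pow_eq_pow_sum, hsum]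
    push_cast
    ring
  have hint : ∀ α ∈ Finset.univ.filter (fun α : Fin n → Fin (j + 1) => ∑ i, (α i).val = j),
      Integrable (fun x : Rn n => ((-1 : ℂ) ^ j / ∏ i, ((α i).val.factorial : ℂ)) *
          (((∏ i, x i ^ (α i).val) * f x : ℝ) : ℂ) *
          ∏ i, (Complex.I * (ξ i : ℂ)) ^ (α i).val) := by
    intro α hα
    have hsum : ∑ i, (α i).val = j := by simpa using hα
    exact ((hf.integrable_prod_pow_mul (fun i => (α i).val) (by rwa [hsum])).ofReal.const_mul
      _).mul_const _
  simp only [hpt]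
  refine ⟨integrable_finsetSum _ hint, ?_⟩
  rw [integral_finsetSum _ hint, mom]
  refine Finset.sum_congr rfl fun α _ => ?_
  rw [integral_mul_const, integral_const_mul, integral_complex_ofReal]

lemma norm_fourierHat_le (n : ℕ) (f : Rn n → ℝ) (ξ : Rn n) :
    ‖fourierHat n f ξ‖ ≤ ∫ x, |f x| := by
  refine (norm_integral_le_integral_norm _).trans_eq (integral_congr_ae (.of_forall fun x => ?_))
  simp [Complex.norm_exp]

lemma fourierHat_sub_sum_mom {n J : ℕ} {β : ℝ} {f : Rn n → ℝ} (hf : MemL1w n β f)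
    (hJ : J ≤ β) (ξ : Rn n) :
    fourierHat n f ξ - ∑ j ∈ Finset.range (J + 1), mom n f j ξ =
      ∫ x : Rn n, expRemainder J (∑ i, x i * ξ i) * (f x : ℂ) := by
  have hmom : ∀ j ∈ Finset.range (J + 1), (j : ℝ) ≤ β := fun j hj =>
    le_trans (by exact_mod_cast Nat.lt_succ_iff.1 (Finset.mem_range.1 hj)) hJ
  have hexp : Integrable (fun x : Rn n =>
      Complex.exp (-Complex.I * ((∑ i, x i * ξ i : ℝ) : ℂ)) * (f x : ℂ)) := by
    refine hf.1.ofReal.bdd_mul (c := 1) (Continuous.aestronglyMeasurable (by fun_prop))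
      (.of_forall fun x => ?_)
    simp [Complex.norm_exp]
  rw [fourierHat, Finset.sum_congr rfl fun j hj =>
    (integrable_and_integral_eq_mom hf (hmom j hj) ξ).2.symm, ← integral_finsetSum _ fun j hj =>
    (integrable_and_integral_eq_mom hf (hmom j hj) ξ).1, ← integral_sub hexp
    (integrable_finsetSum _ fun j hj => (integrable_and_integral_eq_mom hf (hmom j hj) ξ).1)]
  simp only [expRemainder, sub_mul, Finset.sum_mul]

/-- The moment expansion of `f̂` of order `⌊β⌋` for `f ∈ L^{1,β}` has an error which is
`O(|ξ|^β)` everywhere and `o(|ξ|^β)` at the origin. -/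
lemma fourierHat_sub_sum_mom_bound {n J : ℕ} {β : ℝ} {f : Rn n → ℝ} (hf : MemL1w n β f)
    (hJ : J ≤ β) (hβ : β < J + 1) :
    (∃ M, ∀ ξ ≠ 0, ‖fourierHat n f ξ - ∑ j ∈ Finset.range (J + 1), mom n f j ξ‖ / ‖ξ‖ ^ β ≤ M) ∧
    Tendsto (fun ξ => ‖fourierHat n f ξ - ∑ j ∈ Finset.range (J + 1), mom n f j ξ‖ / ‖ξ‖ ^ β)
      (nhdsWithin 0 {0}ᶜ) (nhds 0) := by
  obtain ⟨C, hC, hR⟩ := exists_expRemainder_le J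
  have hβ0 : 0 ≤ β := (Nat.cast_nonneg J).trans hJ
  have hJβ : 0 < (J : ℝ) + 1 - β := by linarith
  have hnorm : ∀ ξ : Rn n,
      ‖fourierHat n f ξ - ∑ j ∈ Finset.range (J + 1), mom n f j ξ‖ / ‖ξ‖ ^ β =
      ‖∫ x : Rn n, (‖ξ‖ ^ β)⁻¹ • (expRemainder J (∑ i, x i * ξ i) * (f x : ℂ))‖ := fun ξ => by
    rw [fourierHat_sub_sum_mom hf hJ, integral_smul, norm_smul, norm_inv,
      Real.norm_of_nonneg (by positivity), div_eq_inv_mul]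
  have hbound : ∀ ξ : Rn n, ξ ≠ 0 → ∀ x : Rn n,
      ‖(‖ξ‖ ^ β)⁻¹ • (expRemainder J (∑ i, x i * ξ i) * (f x : ℂ))‖ ≤
        C * ((1 + ‖x‖) ^ β * |f x|) := by
    intro ξ hξ x
    have hr : 0 < ‖ξ‖ := norm_pos_iff.2 hξ
    rw [norm_smul, norm_inv, Real.norm_of_nonneg (by positivity), norm_mul, Complex.norm_real,
      Real.norm_eq_abs, inv_mul_le_iff₀ (by positivity)]
    calc _ ≤ C * ((1 + ‖x‖) * ‖ξ‖) ^ β * |f x| := by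
          gcongr
          refine ((hR _).2 β hJ hβ.le).trans ?_
          gcongr
          refine (abs_sum_mul_le_norm_mul_norm x ξ).trans ?_
          gcongr
          linarith
      _ = _ := by rw [Real.mul_rpow (by positivity) hr.le]; ring
  have hdecay : ∀ x ξ : Rn n, ξ ≠ 0 →
      ‖(‖ξ‖ ^ β)⁻¹ • (expRemainder J (∑ i, x i * ξ i) * (f x : ℂ))‖ ≤
        C * ‖x‖ ^ (J + 1) * |f x| * ‖ξ‖ ^ ((J : ℝ) + 1 - β) := by
    intro x ξ hξ
    have hr : 0 < ‖ξ‖ := norm_pos_iff.2 hξ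
    rw [norm_smul, norm_inv, Real.norm_of_nonneg (by positivity), norm_mul, Complex.norm_real,
      Real.norm_eq_abs, inv_mul_le_iff₀ (by positivity)]
    calc _ ≤ C * (‖x‖ * ‖ξ‖) ^ (J + 1) * |f x| := by
          gcongr
          refine (hR _).1.trans ?_
          gcongr
          exact abs_sum_mul_le_norm_mul_norm x ξ
      _ = C * ‖x‖ ^ (J + 1) * |f x| * ‖ξ‖ ^ (J + 1) := by ring
      _ = C * ‖x‖ ^ (J + 1) * |f x| * (‖ξ‖ ^ β * ‖ξ‖ ^ ((J : ℝ) + 1 - β)) := by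
          rw [← Real.rpow_add hr, add_sub_cancel, ← Real.rpow_natCast ‖ξ‖ (J + 1)]
          push_cast
          rfl
      _ = _ := by ring
  simp only [hnorm]
  refine ⟨⟨∫ x, C * ((1 + ‖x‖) ^ β * |f x|), fun ξ hξ =>
    norm_integral_le_of_norm_le (hf.2.const_mul C) (.of_forall (hbound ξ hξ))⟩, ?_⟩
  rw [tendsto_zero_iff_norm_tendsto_zero.symm]
  have hne : ∀ᶠ ξ : Rn n in nhdsWithin 0 {0}ᶜ, ξ ≠ 0 := eventually_mem_nhdsWithin
  have key := tendsto_integral_filter_of_dominated_convergence (μ := (volume : Measure (Rn n)))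
    (l := nhdsWithin (0 : Rn n) {0}ᶜ) (f := fun _ => (0 : ℂ))
    (F := fun ξ x => (‖ξ‖ ^ β)⁻¹ • (expRemainder J (∑ i, x i * ξ i) * (f x : ℂ)))
    (fun x => C * ((1 + ‖x‖) ^ β * |f x|)) ?_ ?_ (hf.2.const_mul C) ?_
  · simpa using key
  · refine .of_forall fun ξ => AEStronglyMeasurable.fun_const_smul ?_ _
    refine AEStronglyMeasurable.mul (Continuous.aestronglyMeasurable ?_)
      hf.1.ofReal.aestronglyMeasurable
    exact (continuous_expRemainder J).comp (by fun_prop)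
  · exact hne.mono fun ξ hξ => .of_forall (hbound ξ hξ)
  · refine .of_forall fun x => ?_
    refine squeeze_zero_norm' (hne.mono (hdecay x)) ?_
    have h0 : Tendsto (fun ξ : Rn n => ‖ξ‖ ^ ((J : ℝ) + 1 - β)) (nhdsWithin 0 {0}ᶜ) (nhds 0) := by
      have : Continuous fun ξ : Rn n => ‖ξ‖ ^ ((J : ℝ) + 1 - β) :=
        continuous_norm.rpow_const fun _ => .inr hJβ.le
      simpa [Real.zero_rpow hJβ.ne'] using (this.tendsto 0).mono_left nhdsWithin_le_nhds
    simpa using h0.const_mul (C * ‖x‖ ^ (J + 1) * |f x|)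

/-- The difference between `E₁ û₁` and its asymptotic expansion of order `⌊γ⌋`. -/
def expansionError (n : ℕ) (γ : ℝ) (f : Rn n → ℝ) (t : ℝ) (ξ : Rn n) : ℂ :=
  (E1 n t ξ : ℂ) * fourierHat n f ξ -
    ∑ k ∈ Finset.range (⌊γ⌋₊ + 1), (e1 n k t ξ : ℂ) *
      ∑ j ∈ Finset.range (⌊γ⌋₊ - k + 1), mom n f j ξ

lemma expansionError_bound {n : ℕ} {γ : ℝ} (hγ : 0 ≤ γ) {f : Rn n → ℝ} (hf : MemL1w n γ f) :
    ∃ (ω : Rn n → ℝ) (M : ℝ), Tendsto ω (nhdsWithin 0 {0}ᶜ) (nhds 0) ∧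
      ∀ ξ ≠ 0, ‖ξ‖ ≤ 1 → 0 ≤ ω ξ ∧ ω ξ ≤ M ∧ ∀ t > 0,
        ‖expansionError n γ f t ξ‖ ≤
          ω ξ * (Real.exp (-(t * ‖ξ‖ ^ 2) / 4) * ‖ξ‖ ^ (γ - 1)) := by
  set K := ⌊γ⌋₊ with hK
  have hKγ : (K : ℝ) ≤ γ := Nat.floor_le hγ
  have hγK : γ < K + 1 := Nat.lt_floor_add_one γ
  set ρ : ℕ → Rn n → ℝ := fun k ξ =>
    ‖fourierHat n f ξ - ∑ j ∈ Finset.range (K - k + 1), mom n f j ξ‖ / ‖ξ‖ ^ (γ - k) with hρ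
  have hmom : ∀ k ∈ Finset.range (K + 1), (∃ M, ∀ ξ ≠ 0, ρ k ξ ≤ M) ∧
      Tendsto (ρ k) (nhdsWithin 0 {0}ᶜ) (nhds 0) := by
    intro k hk
    have hk' : k ≤ K := Nat.lt_succ_iff.1 (Finset.mem_range.1 hk)
    have hcast : ((K - k : ℕ) : ℝ) = K - k := Nat.cast_sub hk'
    exact fourierHat_sub_sum_mom_bound
      (hf.mono (sub_le_self γ (Nat.cast_nonneg k))) (by linarith) (by linarith)
  choose C hC he using exists_e1_le n
  obtain ⟨C₀, hC₀, hE⟩ := exists_E1_sub_sum_e1_le n K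
  have hM : ∀ k, ∃ M, k ∈ Finset.range (K + 1) → ∀ ξ ≠ 0, ρ k ξ ≤ M := fun k => by
    by_cases hk : k ∈ Finset.range (K + 1)
    · obtain ⟨M, hM⟩ := (hmom k hk).1
      exact ⟨M, fun _ => hM⟩
    · exact ⟨0, fun h => absurd h hk⟩
  choose M hM using hM
  have hρ0 : ∀ k ξ, 0 ≤ ρ k ξ := fun k ξ => by positivity
  have hB : 0 ≤ ∫ x, |f x| := integral_nonneg fun x => abs_nonneg _
  have hpos : 0 < (K : ℝ) + 1 - γ := by linarith
  refine ⟨fun ξ => C₀ * (∫ x, |f x|) * ‖ξ‖ ^ ((K : ℝ) + 1 - γ) +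
    ∑ k ∈ Finset.range (K + 1), C k * ρ k ξ,
    C₀ * (∫ x, |f x|) + ∑ k ∈ Finset.range (K + 1), C k * M k, ?_, fun ξ hξ hξ1 => ⟨?_, ?_, ?_⟩⟩
  · have h0 : Tendsto (fun ξ : Rn n => ‖ξ‖ ^ ((K : ℝ) + 1 - γ)) (nhdsWithin 0 {0}ᶜ) (nhds 0) := by
      have : Continuous fun ξ : Rn n => ‖ξ‖ ^ ((K : ℝ) + 1 - γ) :=
        continuous_norm.rpow_const fun _ => .inr hpos.le
      simpa [Real.zero_rpow hpos.ne'] using (this.tendsto 0).mono_left nhdsWithin_le_nhds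
    simpa using (h0.const_mul (C₀ * ∫ x, |f x|)).add
      (tendsto_finsetSum (Finset.range (K + 1)) fun k hk => (hmom k hk).2.const_mul (C k))
  · have : 0 ≤ ∑ k ∈ Finset.range (K + 1), C k * ρ k ξ :=
      Finset.sum_nonneg fun k _ => mul_nonneg (hC k) (hρ0 k ξ)
    positivity
  · refine add_le_add ?_ (Finset.sum_le_sum fun k hk => ?_)
    · exact mul_le_of_le_one_right (by positivity)
        (Real.rpow_le_one (norm_nonneg _) hξ1 hpos.le)
    · exact mul_le_mul_of_nonneg_left (hM k hk ξ hξ) (hC k)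
  · intro t ht
    have hr : 0 < ‖ξ‖ := norm_pos_iff.2 hξ
    have hsplit : expansionError n γ f t ξ =
        ((E1 n t ξ - ∑ k ∈ Finset.range (K + 1), e1 n k t ξ : ℝ) : ℂ) * fourierHat n f ξ +
        ∑ k ∈ Finset.range (K + 1), (e1 n k t ξ : ℂ) *
          (fourierHat n f ξ - ∑ j ∈ Finset.range (K - k + 1), mom n f j ξ) := by
      simp only [expansionError, ← hK, mul_sub, Finset.sum_sub_distrib, ← Finset.sum_mul]
      push_cast
      ring
    rw [hsplit, add_mul, Finset.sum_mul]
    refine (norm_add_le _ _).trans (add_le_add ?_ (norm_sum_le_of_le _ fun k hk => ?_))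
    · rw [norm_mul, Complex.norm_real, Real.norm_eq_abs]
      calc _ ≤ C₀ * Real.exp (-(t * ‖ξ‖ ^ 2) / 4) * ‖ξ‖ ^ K * ∫ x, |f x| := by
            gcongr
            · exact hE t ξ ht hξ hξ1
            · exact norm_fourierHat_le n f ξ
        _ = C₀ * Real.exp (-(t * ‖ξ‖ ^ 2) / 4) *
              (‖ξ‖ ^ ((K : ℝ) + 1 - γ) * ‖ξ‖ ^ (γ - 1)) * ∫ x, |f x| := by
            rw [← Real.rpow_add hr, show (K : ℝ) + 1 - γ + (γ - 1) = K by ring,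
              Real.rpow_natCast]
        _ = _ := by ring
    · rw [norm_mul, Complex.norm_real, Real.norm_eq_abs]
      have hρk : ‖fourierHat n f ξ - ∑ j ∈ Finset.range (K - k + 1), mom n f j ξ‖ =
          ρ k ξ * ‖ξ‖ ^ (γ - k) := by
        rw [hρ]; field_simp
      have hpow : ‖ξ‖⁻¹ * ‖ξ‖ ^ k * ‖ξ‖ ^ (γ - k) = ‖ξ‖ ^ (γ - 1) := by
        rw [← Real.rpow_natCast, mul_assoc, ← Real.rpow_add hr, ← Real.rpow_neg_one,
          ← Real.rpow_add hr]
        congr 1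
        ring
      rw [hρk]
      calc _ ≤ C k * Real.exp (-(t * ‖ξ‖ ^ 2) / 4) * (‖ξ‖⁻¹ * ‖ξ‖ ^ k) *
              (ρ k ξ * ‖ξ‖ ^ (γ - k)) := by
            have := hρ0 k ξ
            gcongr
            exact he k t ξ ht hξ
        _ = C k * ρ k ξ * (Real.exp (-(t * ‖ξ‖ ^ 2) / 4) *
              (‖ξ‖⁻¹ * ‖ξ‖ ^ k * ‖ξ‖ ^ (γ - k))) := by ring
        _ = _ := by rw [hpow]

lemma integrable_norm_rpow_mul_exp {n : ℕ} (hn : 1 ≤ n) {s : ℝ} (hs : -(n : ℝ) < s) :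
    Integrable (fun ξ : Rn n => ‖ξ‖ ^ s * Real.exp (-‖ξ‖ ^ 2 / 4)) := by
  have : Nonempty (Fin n) := ⟨⟨0, hn⟩⟩
  refine (integrable_fun_norm_addHaar (volume : Measure (Rn n))
    (f := fun r : ℝ => r ^ s * Real.exp (-r ^ 2 / 4))).2 ?_
  refine (integrableOn_rpow_mul_exp_neg_mul_sq (b := 1 / 4) (by norm_num)
    (s := (n : ℝ) - 1 + s) (by linarith)).congr_fun (fun r (hr : 0 < r) => ?_) measurableSet_Ioi
  simp only [finrank_euclideanSpace_fin, smul_eq_mul]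
  rw [Real.rpow_add hr, ← Nat.cast_one, ← Nat.cast_sub hn, Real.rpow_natCast, mul_assoc]
  congr 3
  push_cast
  ring

lemma norm_rpow_mul_exp_scaling {n : ℕ} (s : ℝ) {t : ℝ} (ht : 0 < t) (ξ : Rn n) :
    ‖ξ‖ ^ s * Real.exp (-(t * ‖ξ‖ ^ 2) / 4) =
      t ^ (-(s / 2)) * (‖Real.sqrt t • ξ‖ ^ s * Real.exp (-‖Real.sqrt t • ξ‖ ^ 2 / 4)) := by
  rw [norm_smul, Real.norm_of_nonneg (Real.sqrt_nonneg t), mul_pow, Real.sq_sqrt ht.le,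
    Real.mul_rpow (Real.sqrt_nonneg t) (norm_nonneg ξ), Real.sqrt_eq_rpow, ← Real.rpow_mul ht.le,
    ← mul_assoc, ← mul_assoc, ← Real.rpow_add ht]
  ring_nf
  simp

lemma integrable_norm_rpow_mul_exp_mul {n : ℕ} (hn : 1 ≤ n) {s : ℝ} (hs : -(n : ℝ) < s)
    {t : ℝ} (ht : 0 < t) :
    Integrable (fun ξ : Rn n => ‖ξ‖ ^ s * Real.exp (-(t * ‖ξ‖ ^ 2) / 4)) := by
  simp only [norm_rpow_mul_exp_scaling s ht]
  exact ((integrable_norm_rpow_mul_exp hn hs).comp_smul (Real.sqrt_pos.2 ht).ne').const_mul _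

lemma integral_norm_rpow_mul_exp_mul (n : ℕ) (s : ℝ) {t : ℝ} (ht : 0 < t) :
    ∫ ξ : Rn n, ‖ξ‖ ^ s * Real.exp (-(t * ‖ξ‖ ^ 2) / 4) =
      t ^ (-((n + s) / 2)) * ∫ ξ : Rn n, ‖ξ‖ ^ s * Real.exp (-‖ξ‖ ^ 2 / 4) := by
  simp only [norm_rpow_mul_exp_scaling s ht]
  rw [integral_const_mul, Measure.integral_comp_smul volume
    (fun ξ : Rn n => ‖ξ‖ ^ s * Real.exp (-‖ξ‖ ^ 2 / 4)), finrank_euclideanSpace_fin,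
    abs_of_nonneg (by positivity), smul_eq_mul, ← mul_assoc]
  congr 1
  rw [Real.sqrt_eq_rpow, ← Real.rpow_natCast, ← Real.rpow_mul ht.le, ← Real.rpow_neg ht.le,
    ← Real.rpow_add ht]
  congr 1
  ring

lemma eventually_sq_mul_exp_le {n : ℕ} {ω : Rn n → ℝ} {M : ℝ}
    (hω : Tendsto ω (nhdsWithin 0 {0}ᶜ) (nhds 0))
    (hM : ∀ ξ ≠ 0, ‖ξ‖ ≤ 1 → 0 ≤ ω ξ ∧ ω ξ ≤ M) {ε : ℝ} (hε : 0 < ε) :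
    ∀ᶠ t : ℝ in atTop, ∀ ξ ≠ 0, ‖ξ‖ ≤ 1 →
      ω ξ ^ 2 * Real.exp (-(t * ‖ξ‖ ^ 2) / 4) ≤ ε := by
  have hω2 : ∀ᶠ ξ in nhdsWithin (0 : Rn n) {0}ᶜ, ω ξ ^ 2 < ε :=
    (show Tendsto (fun ξ => ω ξ ^ 2) _ (nhds 0) by simpa using hω.pow 2).eventually_lt_const hε
  obtain ⟨δ, hδ, hlt⟩ := Metric.eventually_nhds_iff.1 (eventually_nhdsWithin_iff.1 hω2)
  have hexp : Tendsto (fun t : ℝ => M ^ 2 * Real.exp (-(t * (δ ^ 2 / 4)))) atTop (nhds 0) := by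
    simpa using (Real.tendsto_exp_neg_atTop_nhds_zero.comp
      (tendsto_id.atTop_mul_const (by positivity : 0 < δ ^ 2 / 4))).const_mul (M ^ 2)
  filter_upwards [hexp.eventually_lt_const hε, eventually_gt_atTop 0] with t ht ht0 ξ hξ hξ1
  obtain ⟨h0, h1⟩ := hM ξ hξ hξ1
  rcases lt_or_ge ‖ξ‖ δ with h | h
  · have := hlt (by simpa using h) hξ
    calc _ ≤ ε * 1 := by
          gcongr
          exact Real.exp_le_one_iff.2 (by rw [neg_div, neg_nonpos]; positivity)
      _ = ε := mul_one ε
  · refine le_trans ?_ ht.le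
    gcongr
    rw [neg_div, neg_le_neg_iff, mul_div_assoc]
    gcongr

theorem stmt1 (n : ℕ) (hn : 1 ≤ n) (γ : ℝ)
    (hγ1 : n = 1 → 1 / 2 < γ) (hγ2 : n = 2 → 0 < γ) (hγ3 : 3 ≤ n → 0 ≤ γ)
    (u₁ : Rn n → ℝ) (hu₁ : MemL1w n γ u₁) :
    Tendsto (fun t : ℝ => t ^ ((n : ℝ) / 4 + γ / 2 - 1 / 2) *
      Real.sqrt (∫ ξ in Metric.closedBall (0 : Rn n) 1,
        ‖(E1 n t ξ : ℂ) * fourierHat n u₁ ξ -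
          ∑ k ∈ Finset.range (⌊γ⌋₊ + 1), (e1 n k t ξ : ℂ) *
            ∑ j ∈ Finset.range (⌊γ⌋₊ - k + 1), mom n u₁ j ξ‖ ^ 2))
      atTop (nhds 0) := by
  have hγn : 0 ≤ γ ∧ 0 < (n : ℝ) + 2 * (γ - 1) := by
    rcases (by omega : n = 1 ∨ n = 2 ∨ 3 ≤ n) with h | h | h
    · have := hγ1 h
      subst h
      constructor <;> norm_num <;> linarith
    · have := hγ2 h
      subst h
      constructor <;> norm_num <;> linarith
    · have := hγ3 h
      have : (3 : ℝ) ≤ n := by exact_mod_cast h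
      constructor <;> linarith
  obtain ⟨hγ, hs⟩ := hγn
  have : Nonempty (Fin n) := ⟨⟨0, hn⟩⟩
  obtain ⟨ω, M, hω, hbound⟩ := expansionError_bound hγ hu₁
  set s : ℝ := 2 * (γ - 1) with hsdef
  set I := ∫ ξ : Rn n, ‖ξ‖ ^ s * Real.exp (-‖ξ‖ ^ 2 / 4)
  have hI : 0 ≤ I := integral_nonneg fun ξ => by positivity
  set A : ℝ → ℝ := fun t =>
    ∫ ξ in Metric.closedBall (0 : Rn n) 1, ‖expansionError n γ u₁ t ξ‖ ^ 2 with hA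
  have hA0 : ∀ t, 0 ≤ A t := fun t => integral_nonneg fun ξ => by positivity
  have hmain : Tendsto (fun t => t ^ ((n + s) / 2) * A t) atTop (nhds 0) := by
    rw [Metric.tendsto_nhds]
    intro ε hε
    have hε' : 0 < ε / (I + 1) := by positivity
    filter_upwards [eventually_sq_mul_exp_le hω
      (fun ξ hξ hξ1 => ⟨(hbound ξ hξ hξ1).1, (hbound ξ hξ hξ1).2.1⟩) hε', eventually_gt_atTop 0]
      with t ht ht0
    have hint := (integrable_norm_rpow_mul_exp_mul hn (s := s) (by linarith) ht0).const_mul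
      (ε / (I + 1))
    have hAle : A t ≤ ε / (I + 1) * (t ^ (-((n + s) / 2)) * I) := by
      rw [← integral_norm_rpow_mul_exp_mul n s ht0, ← integral_const_mul]
      refine le_trans (integral_mono_of_nonneg (.of_forall fun ξ => by positivity)
        hint.integrableOn ?_) (setIntegral_le_integral hint (.of_forall fun ξ => by positivity))
      have hne : ∀ᵐ ξ : Rn n, ξ ≠ 0 := by simp [ae_iff, measure_singleton]
      filter_upwards [ae_restrict_mem measurableSet_closedBall, ae_restrict_of_ae hne] with ξ hξ hξ0
      have hξ1 : ‖ξ‖ ≤ 1 := by simpa using hξ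
      have hE := (hbound ξ hξ0 hξ1).2.2 t ht0
      calc ‖expansionError n γ u₁ t ξ‖ ^ 2
          ≤ (ω ξ * (Real.exp (-(t * ‖ξ‖ ^ 2) / 4) * ‖ξ‖ ^ (γ - 1))) ^ 2 := by gcongr
        _ = ω ξ ^ 2 * Real.exp (-(t * ‖ξ‖ ^ 2) / 4) *
              (‖ξ‖ ^ s * Real.exp (-(t * ‖ξ‖ ^ 2) / 4)) := by
            rw [hsdef, mul_comm 2, Real.rpow_mul (norm_nonneg ξ), Real.rpow_two]
            ring
        _ ≤ _ := by
            gcongr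
            exact ht ξ hξ0 hξ1
    rw [Real.dist_0_eq_abs, abs_of_nonneg (mul_nonneg (by positivity) (hA0 t))]
    calc _ ≤ t ^ ((n + s) / 2) * (ε / (I + 1) * (t ^ (-((n + s) / 2)) * I)) := by gcongr
      _ = ε / (I + 1) * I := by
          rw [Real.rpow_neg ht0.le]
          field_simp
      _ < ε := by rw [div_mul_eq_mul_div, div_lt_iff₀ (by positivity)]; nlinarith
  have hsqrt := (Real.continuous_sqrt.tendsto 0).comp hmain
  rw [Real.sqrt_zero] at hsqrt
  refine hsqrt.congr' ?_
  filter_upwards [eventually_gt_atTop 0] with t ht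
  rw [Function.comp_apply, Real.sqrt_mul (by positivity), Real.sqrt_eq_rpow (t ^ _),
    ← Real.rpow_mul ht.le]
  congr 2
  rw [hsdef]
  ring
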